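/- arXiv:0904.1968 — 3 statements merged into one kernel-verified Lean document; each statement's English description precedes it below -/
import Mathlib

section
/- Let n = p₁^{r₁} p₂^{r₂} ⋯ p_s^{r_s} where p₁ < p₂ < ⋯ < p_s are primes, let A be a multiset of nonzero elements of ℤ/nℤ of size m, and let X = Cay(ℤ/nℤ, A). If p₁ ≥ m and either s = 1 or p₂ > p₁(m − 1), then for every multiset B of nonzero elements of ℤ/nℤ, if the circulant multigraph Y = Cay(ℤ/nℤ, B) is isospectral to X, then Y is isomorphic to X. -/
/-- Adjacency matrix of the circulant multigraph `Cay(ℤ/nℤ, S)`: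
the `(u,v)` entry is the multiplicity of `v - u` in the connection multiset `S`. -/
def circulantAdj (n : ℕ) [NeZero n] (S : Multiset (ZMod n)) :
    Matrix (ZMod n) (ZMod n) ℂ :=
  Matrix.of fun u v => (S.count (v - u) : ℂ)

open Polynomial in
theorem Multiset.reverse_prod_X_sub_C (s : Multiset ℂ) (hs : ∀ z ∈ s, ‖z‖ = 1) :
    (s.map fun z => X - C z).prod.reverse =
      C ((s.map fun z => X - C z).prod.coeff 0) *
        (s.map fun z => X - C z).prod.map (starRingEnd ℂ) := by
  induction s using Multiset.induction with
  | empty =>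
    have h : (1 : ℂ[X]).reverse = 1 := reverse_C 1
    simp [h]
  | cons z s ih =>
    have hz : z * starRingEnd ℂ z = 1 := by
      rw [Complex.mul_conj']
      simp [hs z (Multiset.mem_cons_self z s)]
    have hrev : (X - C z).reverse = C (-z) * (X - C (starRingEnd ℂ z)) := by
      have h : (X - C z).reverse = 1 - C z * X := by
        rw [reverse, natDegree_X_sub_C, reflect_sub, reflect_one_X, reflect_C, pow_one]
      rw [h, mul_sub, ← C_mul, neg_mul, hz]
      simp
      ring
    rw [Multiset.map_cons, Multiset.prod_cons, reverse_mul_of_domain, hrev,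
      ih fun w hw => hs w (Multiset.mem_cons_of_mem hw), mul_coeff_zero]
    simp
    ring

theorem Multiset.exists_fin_map {α : Type*} (s : Multiset α) (m : ℕ) (hs : s.card = m) :
    ∃ f : Fin m → α, s = Finset.univ.val.map f := by
  subst hs
  obtain ⟨l, rfl⟩ := Quot.exists_rep s
  refine ⟨l.get, ?_⟩
  refine Eq.trans ?_ (Fin.univ_val_map _).symm
  exact congrArg _ (List.ofFn_get l).symm

/-- Newton's identities: equal power sums give equal elementary symmetric functions. -/
theorem Multiset.esymm_eq_of_powerSum_eq {s t : Multiset ℂ} (hst : s.card = t.card) (k : ℕ)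
    (h : ∀ i, 0 < i → i ≤ k → (s.map (· ^ i)).sum = (t.map (· ^ i)).sum) :
    s.esymm k = t.esymm k := by
  obtain ⟨x, hx⟩ := s.exists_fin_map _ hst
  obtain ⟨y, hy⟩ := t.exists_fin_map _ rfl
  generalize t.card = m at x y
  subst hx hy
  induction k using Nat.strong_induction_on with
  | _ k ih =>
    rcases Nat.eq_zero_or_pos k with rfl | hk
    · simp [Multiset.esymm]
    have key : ∀ z : Fin m → ℂ, (k : ℂ) * (Finset.univ.val.map z).esymm k =
        (-1) ^ (k + 1) * ∑ a ∈ Finset.HasAntidiagonal.antidiagonal k with a.1 < k,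
          (-1) ^ a.1 * (Finset.univ.val.map z).esymm a.1 *
            ((Finset.univ.val.map z).map (· ^ a.2)).sum := by
      intro z
      have := congrArg (MvPolynomial.aeval z) (MvPolynomial.mul_esymm_eq_sum (Fin m) ℂ k)
      simpa only [map_mul, map_pow, map_neg, map_one, map_natCast, map_sum, MvPolynomial.psum,
        MvPolynomial.aeval_X, MvPolynomial.aeval_esymm_eq_multiset_esymm, Multiset.map_map,
        Function.comp_def, Finset.sum_map_val] using this
    refine mul_left_cancel₀ (Nat.cast_ne_zero.mpr hk.ne' : (k : ℂ) ≠ 0) ?_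
    rw [key, key]
    congr 1
    refine Finset.sum_congr rfl fun a ha => ?_
    simp only [Finset.mem_filter, Finset.HasAntidiagonal.mem_antidiagonal] at ha
    rw [ih a.1 ha.2 fun i hi hia => h i hi (by omega), h a.2 (by omega) (by omega)]

open Polynomial in
theorem Multiset.eq_or_pow_eq_of_powerSum_eq {s t : Multiset ℂ} (hs : ∀ z ∈ s, ‖z‖ = 1)
    (ht : ∀ z ∈ t, ‖z‖ = 1) (hst : s.card = t.card)
    (h : ∀ i, 0 < i → i < s.card → (s.map (· ^ i)).sum = (t.map (· ^ i)).sum) :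
    s = t ∨ s.Nodup ∧ ∃ c, ∀ z ∈ s, z ^ s.card = c := by
  set P := (s.map fun z => X - C z).prod with hP
  set Q := (t.map fun z => X - C z).prod with hQ
  have hPdeg : P.natDegree = s.card := natDegree_multiset_prod_X_sub_C_eq_card s
  have hQdeg : Q.natDegree = s.card := hst ▸ natDegree_multiset_prod_X_sub_C_eq_card t
  have hPm : P.Monic := monic_multiset_prod_of_monic _ _ fun z _ => monic_X_sub_C z
  have hQm : Q.Monic := monic_multiset_prod_of_monic _ _ fun z _ => monic_X_sub_C z
  have hcoeff : ∀ k, 0 < k → k < s.card → P.coeff k = Q.coeff k := by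
    intro k hk hks
    rw [hP, hQ, Multiset.prod_X_sub_C_coeff _ hks.le,
      Multiset.prod_X_sub_C_coeff _ (hst ▸ hks.le), ← hst,
      Multiset.esymm_eq_of_powerSum_eq hst _ fun i hi hik => h i hi (by omega)]
  have hrev : ∀ {u : Multiset ℂ}, (∀ z ∈ u, ‖z‖ = 1) → ∀ k ≤ u.card,
      (u.map fun z => X - C z).prod.coeff (u.card - k) =
        (u.map fun z => X - C z).prod.coeff 0 *
          starRingEnd ℂ ((u.map fun z => X - C z).prod.coeff k) := by
    intro u hu k hk
    have := congrArg (fun p => p.coeff k) (u.reverse_prod_X_sub_C hu)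
    simpa [coeff_reverse, natDegree_multiset_prod_X_sub_C_eq_card, revAt_le hk] using this
  by_cases h0 : P.coeff 0 = Q.coeff 0
  · left
    have hPQ : P = Q := by
      ext k
      rcases Nat.eq_zero_or_pos k with rfl | hk
      · exact h0
      rcases lt_trichotomy k s.card with hks | rfl | hks
      · exact hcoeff k hk hks
      · rw [← hPdeg, hPm.coeff_natDegree, hPdeg, ← hQdeg, hQm.coeff_natDegree]
      · rw [coeff_eq_zero_of_natDegree_lt (hPdeg ▸ hks),
          coeff_eq_zero_of_natDegree_lt (hQdeg ▸ hks)]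
    simpa [hP, hQ] using congrArg Polynomial.roots hPQ
  · right
    have hzero : ∀ k, 0 < k → k < s.card → P.coeff k = 0 := by
      intro k hk hks
      have h1 := hrev hs k hks.le
      have h2 := hrev ht k (hst ▸ hks.le)
      rw [← hP] at h1
      rw [← hQ, ← hst, ← hcoeff _ (by omega) (by omega), h1, ← hcoeff k hk hks] at h2
      simpa using (mul_eq_mul_right_iff.mp h2).resolve_left h0
    have hcard : s.card ≠ 0 := by
      intro hc
      rw [Multiset.card_eq_zero.mp hc, Multiset.card_zero, eq_comm, Multiset.card_eq_zero] at hst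
      simp [hP, hQ, hst, Multiset.card_eq_zero.mp hc] at h0
    have hPX : P = X ^ s.card - C (-P.coeff 0) := by
      ext k
      rcases Nat.eq_zero_or_pos k with rfl | hk
      · simp [hcard.symm]
      rcases lt_trichotomy k s.card with hks | rfl | hks
      · simp [hzero k hk hks, coeff_X_pow, hks.ne, coeff_C, hk.ne']
      · rw [← hPdeg, hPm.coeff_natDegree, hPdeg]
        simp [coeff_C, hcard]
      · rw [coeff_eq_zero_of_natDegree_lt (hPdeg ▸ hks)]
        simp [coeff_X_pow, hks.ne', coeff_C, hk.ne']
    have hroots : P.roots = s := roots_multiset_prod_X_sub_C s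
    have hP0 : P.coeff 0 ≠ 0 := by
      rw [hP, coeff_zero_multiset_prod]
      refine Multiset.prod_ne_zero fun h => ?_
      simp only [Multiset.map_map, Function.comp, Multiset.mem_map] at h
      obtain ⟨z, hz, hz0⟩ := h
      have := hs z hz
      rw [coeff_sub, coeff_X_zero, coeff_C_zero, zero_sub, neg_eq_zero] at hz0
      simp [hz0] at this
    refine ⟨?_, -P.coeff 0, fun z hz => ?_⟩
    · rw [← hroots]
      refine nodup_roots ?_
      rw [hPX]
      exact separable_X_pow_sub_C _ (Nat.cast_ne_zero.mpr hcard) (neg_ne_zero.mpr hP0)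
    · have hz' : z ∈ P.roots := hroots.symm ▸ hz
      have := (mem_roots'.mp hz').2
      rw [hPX] at this
      simpa [sub_eq_zero, add_eq_zero_iff_eq_neg] using this

/-- The eigenvalue of `circulantAdj n S` at the character `x ↦ ψ (k * x)`. -/
noncomputable def circulantEigenvalue (n : ℕ) [NeZero n] (S : Multiset (ZMod n)) (k : ZMod n) : ℂ :=
  (S.map fun a => ZMod.stdAddChar (k * a)).sum

namespace circulantEigenvalue

variable {n : ℕ} [NeZero n]

theorem norm_stdAddChar (x : ZMod n) : ‖ZMod.stdAddChar x‖ = 1 := by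
  rw [ZMod.stdAddChar_apply, Circle.norm_coe]

theorem eq_sum_count (S : Multiset (ZMod n)) (k : ZMod n) :
    circulantEigenvalue n S k = ∑ a, (S.count a : ℂ) * ZMod.stdAddChar (k * a) := by
  rw [circulantEigenvalue, Finset.sum_multiset_map_count,
    Finset.sum_subset (Finset.subset_univ _)]
  · simp
  · intro x _ hx
    rw [Multiset.mem_toFinset, ← Multiset.count_eq_zero] at hx
    simp [hx]

open Polynomial in
theorem charpoly_circulantAdj (S : Multiset (ZMod n)) :
    (circulantAdj n S).charpoly = ∏ k, (X - C (circulantEigenvalue n S k)) := by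
  let F : Matrix (ZMod n) (ZMod n) ℂ := Matrix.of fun v k => ZMod.stdAddChar (v * k)
  let G : Matrix (ZMod n) (ZMod n) ℂ := Matrix.of fun k v => (n : ℂ)⁻¹ * ZMod.stdAddChar (-(k * v))
  have hn : (n : ℂ) ≠ 0 := Nat.cast_ne_zero.mpr (NeZero.ne n)
  have hFG : F * G = 1 := by
    ext v w
    have h := AddChar.sum_mulShift (v - w) (ZMod.isPrimitive_stdAddChar n)
    simp only [Matrix.mul_apply, F, G, Matrix.of_apply, Matrix.one_apply]
    calc ∑ k, ZMod.stdAddChar (v * k) * ((n : ℂ)⁻¹ * ZMod.stdAddChar (-(k * w)))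
        = (n : ℂ)⁻¹ * ∑ k, ZMod.stdAddChar (k * (v - w)) := by
          rw [Finset.mul_sum]
          refine Finset.sum_congr rfl fun k _ => ?_
          rw [mul_left_comm, ← AddChar.map_add_eq_mul]
          ring_nf
      _ = if v = w then 1 else 0 := by
          rw [h]
          simp [sub_eq_zero, ZMod.card, hn]
  have hGF : G * F = 1 := mul_eq_one_comm.mp hFG
  have hdiag : circulantAdj n S * F = F * Matrix.diagonal (circulantEigenvalue n S) := by
    ext u k
    rw [Matrix.mul_diagonal, Matrix.mul_apply, eq_sum_count, Finset.mul_sum,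
      ← Equiv.sum_comp (Equiv.addRight u)]
    refine Finset.sum_congr rfl fun a _ => ?_
    simp only [circulantAdj, F, Matrix.of_apply, Equiv.coe_addRight, add_sub_cancel_right]
    rw [mul_left_comm, ← AddChar.map_add_eq_mul]
    ring_nf
  have hconj : circulantAdj n S = F * Matrix.diagonal (circulantEigenvalue n S) * G := by
    rw [← hdiag, Matrix.mul_assoc, hFG, Matrix.mul_one]
  have h := Matrix.charpoly_units_conj (Units.mk F G hFG hGF)
    (Matrix.diagonal (circulantEigenvalue n S))
  rw [Units.val_mk, Matrix.inv_eq_right_inv hFG] at h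
  rw [hconj, ← Matrix.charpoly_diagonal, h]

theorem map_univ_eq_of_charpoly_eq {A B : Multiset (ZMod n)}
    (h : (circulantAdj n B).charpoly = (circulantAdj n A).charpoly) :
    Finset.univ.val.map (circulantEigenvalue n B) =
      Finset.univ.val.map (circulantEigenvalue n A) := by
  rw [charpoly_circulantAdj, charpoly_circulantAdj] at h
  have hroots : ∀ S : Multiset (ZMod n),
      (∏ k, (Polynomial.X - Polynomial.C (circulantEigenvalue n S k))).roots =
        Finset.univ.val.map (circulantEigenvalue n S) := by
    intro S
    have := Polynomial.roots_multiset_prod_X_sub_C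
      (Finset.univ.val.map (circulantEigenvalue n S))
    rwa [Multiset.map_map] at this
  rw [← hroots, h, hroots]

theorem zero_right (S : Multiset (ZMod n)) : circulantEigenvalue n S 0 = S.card := by
  simp [circulantEigenvalue]

theorem norm_le_card (S : Multiset (ZMod n)) (k : ZMod n) :
    ‖circulantEigenvalue n S k‖ ≤ S.card := by
  refine (norm_multiset_sum_le _).trans_eq ?_
  simp

theorem eq_card_iff (S : Multiset (ZMod n)) (k : ZMod n) :
    circulantEigenvalue n S k = S.card ↔ ∀ a ∈ S, k * a = 0 := by
  constructor
  · intro h a ha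
    have hsum : (S.map fun a => 1 - (ZMod.stdAddChar (k * a)).re).sum = 0 := by
      have := congrArg Complex.re h
      rw [circulantEigenvalue, ← Complex.coe_reAddGroupHom, map_multiset_sum,
        Multiset.map_map] at this
      rw [Multiset.sum_map_sub]
      simpa [sub_eq_zero] using this.symm
    have hnonneg : ∀ x ∈ S.map fun a => 1 - (ZMod.stdAddChar (k * a)).re, 0 ≤ x := by
      intro x hx
      obtain ⟨b, -, rfl⟩ := Multiset.mem_map.mp hx
      exact sub_nonneg.mpr ((Complex.re_le_norm _).trans_eq (norm_stdAddChar _))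
    have hre := Multiset.all_zero_of_le_zero_le_of_sum_eq_zero hnonneg hsum _
      (Multiset.mem_map_of_mem _ ha)
    have h1 : ZMod.stdAddChar (k * a) = 1 := by
      have hnorm := norm_stdAddChar (k * a)
      have him := Complex.sq_norm_sub_sq_re (ZMod.stdAddChar (k * a))
      rw [hnorm, ← sub_eq_zero.mp hre] at him
      refine Complex.ext (by simp; linarith) ?_
      simpa using him.symm
    rw [← AddChar.map_zero_eq_one (ZMod.stdAddChar (N := n))] at h1
    exact ZMod.injective_stdAddChar h1
  · intro h
    rw [circulantEigenvalue, Multiset.map_congr rfl fun a ha => by rw [h a ha]]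
    simp

end circulantEigenvalue

section Isospectral

variable {n : ℕ} [NeZero n] {A B : Multiset (ZMod n)}

theorem card_le_of_map_eigenvalue_eq (h : Finset.univ.val.map (circulantEigenvalue n B) =
      Finset.univ.val.map (circulantEigenvalue n A)) : A.card ≤ B.card := by
  have h0 : circulantEigenvalue n A 0 ∈ Finset.univ.val.map (circulantEigenvalue n B) := by
    rw [h]
    exact Multiset.mem_map_of_mem _ (Finset.mem_univ 0)
  obtain ⟨k, -, hk⟩ := Multiset.mem_map.mp h0
  have := circulantEigenvalue.norm_le_card B k
  rw [hk, circulantEigenvalue.zero_right, Complex.norm_natCast] at this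
  exact_mod_cast this

theorem ZMod.finset_eq_of_nsmul_eq_zero {s t : Finset (ZMod n)} (hst : s.card = t.card)
    (hs : ∀ x ∈ s, s.card • x = 0) (ht : ∀ x ∈ t, s.card • x = 0) : s = t := by
  rcases Nat.eq_zero_or_pos s.card with h0 | hpos
  · rw [Finset.card_eq_zero.mp h0, eq_comm, ← Finset.card_eq_zero, ← hst, h0]
  have hle := IsAddCyclic.card_nsmul_eq_zero_le (α := ZMod n) hpos
  have key : ∀ u : Finset (ZMod n), u.card = s.card → (∀ x ∈ u, s.card • x = 0) →
      u = Finset.univ.filter fun x => s.card • x = 0 := by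
    intro u hu h
    refine Finset.eq_of_subset_of_card_le (fun x hx => by simpa using h x hx) ?_
    rw [hu]
    convert hle
  rw [key s rfl hs, key t hst.symm ht]

theorem annihilator_iff_of_map_eigenvalue_eq
    (h : Finset.univ.val.map (circulantEigenvalue n B) =
      Finset.univ.val.map (circulantEigenvalue n A)) (hcard : B.card = A.card) (k : ZMod n) :
    (∀ b ∈ B, k * b = 0) ↔ ∀ a ∈ A, k * a = 0 := by
  classical
  let ann (S : Multiset (ZMod n)) : AddSubgroup (ZMod n) :=
    { carrier := {k | ∀ a ∈ S, k * a = 0}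
      add_mem' := fun hx hy a ha => by rw [add_mul, hx a ha, hy a ha, add_zero]
      zero_mem' := fun a _ => zero_mul a
      neg_mem' := fun hx a ha => by rw [neg_mul, hx a ha, neg_zero] }
  have hann : ∀ S : Multiset (ZMod n), ∀ x ∈ Finset.univ.filter (· ∈ ann S),
      (Finset.univ.filter (· ∈ ann S)).card • x = 0 := by
    intro S x hx
    have hx' : x ∈ ann S := by simpa using hx
    have : (Finset.univ.filter (· ∈ ann S)).card = Fintype.card (ann S) :=
      (Fintype.card_subtype _).symm
    rw [this]
    exact congrArg Subtype.val (card_nsmul_eq_zero (x := (⟨x, hx'⟩ : ann S)))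
  have hcount : (Finset.univ.filter (· ∈ ann B)).card = (Finset.univ.filter (· ∈ ann A)).card := by
    have := congrArg (Multiset.count (A.card : ℂ)) h
    rw [Multiset.count_map, Multiset.count_map] at this
    have hS : ∀ S : Multiset (ZMod n), S.card = A.card → Multiset.card
        (Finset.univ.val.filter fun k => (A.card : ℂ) = circulantEigenvalue n S k) =
          (Finset.univ.filter (· ∈ ann S)).card := by
      intro S hS
      rw [Finset.card_def, Finset.filter_val]
      congr 1
      refine Multiset.filter_congr fun k _ => ?_
      rw [← hS, eq_comm, circulantEigenvalue.eq_card_iff]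
      rfl
    rwa [hS B hcard, hS A rfl] at this
  have heq := ZMod.finset_eq_of_nsmul_eq_zero hcount (hann B) (hcount ▸ hann A)
  simpa [ann, AddSubgroup.mem_mk] using Finset.ext_iff.mp heq k

theorem ZMod.exists_unit_mul_eq_of_annihilator {x y : ZMod n}
    (h : ∀ k : ZMod n, k * x = 0 ↔ k * y = 0) : ∃ u : (ZMod n)ˣ, y = u * x := by
  obtain ⟨d, hd, u, hu, rfl⟩ := x.eq_unit_mul_divisor
  obtain ⟨e, he, v, hv, rfl⟩ := y.eq_unit_mul_divisor
  have key : ∀ {d e : ℕ} {u v : ZMod n}, d ∣ n → IsUnit u → IsUnit v →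
      (∀ k : ZMod n, k * (u * d) = 0 → k * (v * e) = 0) → d ∣ e := by
    intro d e u v hd hu hv h
    obtain ⟨c, hc⟩ := hd
    have h1 := h c (by
      rw [mul_left_comm, ← Nat.cast_mul, mul_comm c, ← hc, ZMod.natCast_self, mul_zero])
    rw [mul_left_comm, hv.mul_right_eq_zero, ← Nat.cast_mul, ZMod.natCast_eq_zero_iff, hc,
      mul_comm d] at h1
    have hc0 : 0 < c := Nat.pos_of_ne_zero fun h0 => NeZero.ne n (by rw [hc, h0, mul_zero])
    exact Nat.dvd_of_mul_dvd_mul_left hc0 h1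
  have hde : d = e := Nat.dvd_antisymm (key hd hu hv fun k => (h k).mp)
    (key he hv hu fun k => (h k).mpr)
  subst hde
  refine ⟨hv.unit * hu.unit⁻¹, ?_⟩
  rw [Units.val_mul, IsUnit.unit_spec, mul_assoc, ← mul_assoc _ u, IsUnit.val_inv_mul, one_mul]

/-- If multiplication by `j` preserves the annihilator of `A`, it acts on `A` as a unit. -/
theorem ZMod.exists_unit_map_mul_eq {j : ZMod n}
    (h : ∀ k : ZMod n, (∀ a ∈ A.map (j * ·), k * a = 0) → ∀ a ∈ A, k * a = 0) :
    ∃ u : (ZMod n)ˣ, A.map (j * ·) = A.map ((u : ZMod n) * ·) := by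
  have : IsPrincipalIdealRing (ZMod n) :=
    .of_surjective (Int.castRingHom (ZMod n)) ZMod.intCast_surjective
  obtain ⟨g, hg⟩ := (IsPrincipalIdealRing.principal (Ideal.span {a | a ∈ A})).principal
  rw [← Ideal.span] at hg
  have hgann : ∀ k : ZMod n, (∀ a ∈ A, k * a = 0) → k * g = 0 := by
    intro k hk
    have hle : Ideal.span {a | a ∈ A} ≤ LinearMap.ker (LinearMap.mulLeft (ZMod n) k) :=
      Ideal.span_le.mpr fun a ha => hk a ha
    exact hle (hg ▸ Ideal.mem_span_singleton_self g)
  have hdvd : ∀ a ∈ A, g ∣ a := fun a ha =>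
    Ideal.mem_span_singleton.mp (hg ▸ Ideal.subset_span ha)
  obtain ⟨u, hu⟩ := ZMod.exists_unit_mul_eq_of_annihilator (x := g) (y := j * g) fun k => by
    constructor
    · intro hk
      rw [mul_left_comm, hk, mul_zero]
    · refine fun hk => hgann k (h k ?_)
      intro b hb
      obtain ⟨a, ha, rfl⟩ := Multiset.mem_map.mp hb
      obtain ⟨c, rfl⟩ := hdvd a ha
      rw [← mul_assoc j, ← mul_assoc, hk, zero_mul]
  refine ⟨u, Multiset.map_congr rfl fun a ha => ?_⟩
  obtain ⟨c, rfl⟩ := hdvd a ha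
  rw [← mul_assoc, hu, mul_assoc]

/-- An equality of sums of `n`-th roots of unity is preserved by raising the roots to a power
prime to `n`. -/
theorem circulantEigenvalue.eq_natCast_of_coprime {S T : Multiset (ZMod n)}
    (h : circulantEigenvalue n S 1 = circulantEigenvalue n T 1) {i : ℕ} (hi : i.Coprime n) :
    circulantEigenvalue n S i = circulantEigenvalue n T i := by
  set ζ : ℂ := ZMod.stdAddChar (1 : ZMod n) with hζdef
  have hζ : IsPrimitiveRoot ζ n := by
    have := Complex.isPrimitiveRoot_exp n (NeZero.ne n)
    have h1 := ZMod.stdAddChar_coe (N := n) 1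
    rw [Int.cast_one, Int.cast_one, mul_one] at h1
    rwa [← h1] at this
  have hpow : ∀ a : ZMod n, ZMod.stdAddChar a = ζ ^ a.val := by
    intro a
    rw [hζdef, ← AddChar.map_nsmul_eq_pow, nsmul_one, ZMod.natCast_zmod_val]
  have heval : ∀ (U : Multiset (ZMod n)) (i : ℕ), circulantEigenvalue n U i =
      Polynomial.aeval (ζ ^ i) (U.map fun a => (Polynomial.X ^ a.val : Polynomial ℤ)).sum := by
    intro U i
    rw [map_multiset_sum, Multiset.map_map, circulantEigenvalue]
    refine congrArg _ (Multiset.map_congr rfl fun a _ => ?_)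
    simp only [Function.comp, map_pow, Polynomial.aeval_X]
    rw [← nsmul_eq_mul, AddChar.map_nsmul_eq_pow, hpow, pow_right_comm]
  have h1 := heval S 1
  have h2 := heval T 1
  rw [Nat.cast_one, pow_one] at h1 h2
  rw [h1, h2, ← sub_eq_zero, ← map_sub] at h
  have hdvd := minpoly.isIntegrallyClosed_dvd (hζ.isIntegral (NeZero.pos n)) h
  rw [hζ.minpoly_eq_pow_coprime hi] at hdvd
  rw [heval, heval, ← sub_eq_zero, ← map_sub]
  exact Polynomial.aeval_eq_zero_of_dvd_aeval_eq_zero hdvd (minpoly.aeval ℤ _)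

theorem circulantEigenvalue.eq_or_nodup_and_nsmul_eq {S T : Multiset (ZMod n)}
    (h : circulantEigenvalue n S 1 = circulantEigenvalue n T 1) (hcard : S.card = T.card)
    (hcop : ∀ i, 0 < i → i < S.card → i.Coprime n) :
    S = T ∨ S.Nodup ∧ ∀ x ∈ S, ∀ y ∈ S, S.card • x = S.card • y := by
  have hnorm : ∀ U : Multiset (ZMod n), ∀ z ∈ U.map ZMod.stdAddChar, ‖z‖ = 1 := by
    intro U z hz
    obtain ⟨a, -, rfl⟩ := Multiset.mem_map.mp hz
    exact norm_stdAddChar a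
  have hsum : ∀ (U : Multiset (ZMod n)) (i : ℕ),
      ((U.map ZMod.stdAddChar).map (· ^ i)).sum = circulantEigenvalue n U i := by
    intro U i
    rw [Multiset.map_map, circulantEigenvalue]
    refine congrArg _ (Multiset.map_congr rfl fun a _ => ?_)
    rw [← nsmul_eq_mul, AddChar.map_nsmul_eq_pow]
    rfl
  rcases Multiset.eq_or_pow_eq_of_powerSum_eq (hnorm S) (hnorm T) (by simpa using hcard)
    fun i hi hiS => by
      rw [Multiset.card_map] at hiS
      rw [hsum, hsum, eq_natCast_of_coprime h (hcop i hi hiS)] with hST | ⟨hnd, c, hc⟩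
  · exact .inl (Multiset.map_injective ZMod.injective_stdAddChar hST)
  · refine .inr ⟨.of_map _ hnd, fun x hx y hy => ZMod.injective_stdAddChar ?_⟩
    rw [Multiset.card_map] at hc
    rw [AddChar.map_nsmul_eq_pow, AddChar.map_nsmul_eq_pow, hc _ (Multiset.mem_map_of_mem _ hx),
      hc _ (Multiset.mem_map_of_mem _ hy)]

theorem exists_unit_map_or_nodup_and_nsmul_eq
    (h : Finset.univ.val.map (circulantEigenvalue n B) =
      Finset.univ.val.map (circulantEigenvalue n A)) (hcard : B.card = A.card)
    (hcop : ∀ i, 0 < i → i < B.card → i.Coprime n) :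
    (∃ u : (ZMod n)ˣ, B = A.map ((u : ZMod n) * ·)) ∨
      B.Nodup ∧ ∀ x ∈ B, ∀ y ∈ B, B.card • x = B.card • y := by
  have h1 : circulantEigenvalue n B 1 ∈ Finset.univ.val.map (circulantEigenvalue n A) := by
    rw [← h]
    exact Multiset.mem_map_of_mem _ (Finset.mem_univ 1)
  obtain ⟨j, -, hj⟩ := Multiset.mem_map.mp h1
  have hj' : circulantEigenvalue n (A.map (j * ·)) 1 = circulantEigenvalue n A j := by
    simp [circulantEigenvalue, Multiset.map_map]
  refine (circulantEigenvalue.eq_or_nodup_and_nsmul_eq (hj'.trans hj).symm (by simpa using hcard)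
    hcop).imp_left fun hB => ?_
  obtain ⟨u, hu⟩ := ZMod.exists_unit_map_mul_eq (A := A) (j := j) fun k hk =>
    (annihilator_iff_of_map_eigenvalue_eq h hcard k).mp (hB ▸ hk)
  exact ⟨u, hB.trans hu⟩

theorem exists_unit_map_of_map_eigenvalue_eq
    (h : Finset.univ.val.map (circulantEigenvalue n B) =
      Finset.univ.val.map (circulantEigenvalue n A))
    (hcop : ∀ i, 0 < i → i < A.card → i.Coprime n) :
    ∃ u : (ZMod n)ˣ, B = A.map ((u : ZMod n) * ·) := by
  have hcard : B.card = A.card :=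
    le_antisymm (card_le_of_map_eigenvalue_eq h.symm) (card_le_of_map_eigenvalue_eq h)
  rcases exists_unit_map_or_nodup_and_nsmul_eq h hcard (hcard ▸ hcop) with hu | ⟨hBnd, hB⟩
  · exact hu
  rcases exists_unit_map_or_nodup_and_nsmul_eq h.symm hcard.symm hcop with ⟨u, rfl⟩ | ⟨hAnd, hA⟩
  · exact ⟨u⁻¹, by simp [Multiset.map_map]⟩
  rcases A.empty_or_exists_mem with rfl | ⟨a₀, ha₀⟩
  · exact ⟨1, by simpa using hcard⟩
  obtain ⟨b₀, hb₀⟩ := Multiset.card_pos_iff_exists_mem.mp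
    (hcard ▸ Multiset.card_pos_iff_exists_mem.mpr ⟨a₀, ha₀⟩)
  have hann : ∀ {S : Multiset (ZMod n)} {x₀ : ZMod n}, x₀ ∈ S →
      (∀ x ∈ S, ∀ y ∈ S, S.card • x = S.card • y) → ∀ k : ZMod n,
        k * S.card • x₀ = 0 ↔ ∀ x ∈ S, k * (S.card : ZMod n) * x = 0 := by
    intro S x₀ hx₀ hS k
    simp only [mul_assoc, ← nsmul_eq_mul]
    exact ⟨fun hk x hx => hS x hx x₀ hx₀ ▸ hk, fun hk => hk x₀ hx₀⟩
  obtain ⟨u, hu⟩ := ZMod.exists_unit_mul_eq_of_annihilator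
    (x := A.card • a₀) (y := A.card • b₀) fun k => by
      rw [hann ha₀ hA, ← annihilator_iff_of_map_eigenvalue_eq h hcard, ← hcard, hann hb₀ hB]
  have hAund : (A.map ((u : ZMod n) * ·)).Nodup := hAnd.map u.isUnit.mul_right_injective
  refine ⟨u, ?_⟩
  have hfin : (B.map (· - b₀)).toFinset = ((A.map ((u : ZMod n) * ·)).map (· - b₀)).toFinset := by
    have hBcard : (B.map (· - b₀)).toFinset.card = A.card := by
      rw [Multiset.toFinset_card_of_nodup (hBnd.map sub_left_injective), Multiset.card_map, hcard]
    refine ZMod.finset_eq_of_nsmul_eq_zero ?_ ?_ ?_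
    · rw [hBcard, Multiset.toFinset_card_of_nodup (hAund.map sub_left_injective),
        Multiset.card_map, Multiset.card_map]
    · intro x hx
      obtain ⟨b, hb, rfl⟩ := Multiset.mem_map.mp (Multiset.mem_toFinset.mp hx)
      rw [hBcard, nsmul_sub, ← hcard, hB b hb b₀ hb₀, sub_self]
    · intro x hx
      rw [Multiset.map_map] at hx
      obtain ⟨a, ha, rfl⟩ := Multiset.mem_map.mp (Multiset.mem_toFinset.mp hx)
      rw [hBcard, Function.comp_apply, nsmul_sub, hu, ← hA a ha a₀ ha₀, mul_smul_comm, sub_self]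
  refine Multiset.map_injective (sub_left_injective (b := b₀)) ?_
  rw [← Multiset.dedup_eq_self.mpr (hBnd.map (sub_left_injective (b := b₀))),
    ← Multiset.dedup_eq_self.mpr (hAund.map (sub_left_injective (b := b₀)))]
  exact congrArg Finset.val hfin

theorem circulantAdj_map_unit_mul (u : (ZMod n)ˣ) :
    circulantAdj n (A.map ((u : ZMod n) * ·)) =
      (circulantAdj n A).submatrix u⁻¹.mulLeft u⁻¹.mulLeft := by
  ext v w
  simp only [circulantAdj, Matrix.of_apply, Matrix.submatrix_apply, Units.mulLeft_apply]
  rw [← mul_sub, ← Multiset.count_map_eq_count' _ A u.isUnit.mul_right_injective,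
    Units.mul_inv_cancel_left]

end Isospectral

/-- Main theorem: let `n = p₁^{r₁} ⋯ p_s^{r_s}` with primes `p₁ < ⋯ < p_s` and let
`X = Cay(ℤ/nℤ, A)` be a circulant multigraph whose connection multiset `A` (of
nonzero elements) has size `m`.  If `p₁ ≥ m` and either `s = 1` or
`p₂ > p₁(m − 1)`, then every circulant multigraph `Y = Cay(ℤ/nℤ, B)` isospectral
to `X` (equal characteristic polynomials of the adjacency matrices) is isomorphic
to `X` (the adjacency matrices are conjugate by a permutation). -/
theorem isospectral_implies_isomorphic (s : ℕ) (hs : 0 < s)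
    (p r : Fin s → ℕ) (hp : ∀ i, (p i).Prime) (hmono : StrictMono p)
    (hr : ∀ i, 1 ≤ r i)
    (n : ℕ) [NeZero n] (hn : n = ∏ i, p i ^ r i)
    (m : ℕ) (A : Multiset (ZMod n)) (hA0 : (0 : ZMod n) ∉ A)
    (hAm : Multiset.card A = m)
    (hm : m ≤ p ⟨0, hs⟩)
    (hcond : ∀ h : 1 < s, p ⟨0, hs⟩ * (m - 1) < p ⟨1, h⟩) :
    ∀ B : Multiset (ZMod n), (0 : ZMod n) ∉ B →
      (circulantAdj n B).charpoly = (circulantAdj n A).charpoly →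
      ∃ e : Equiv.Perm (ZMod n),
        circulantAdj n B = (circulantAdj n A).submatrix e e := by
  intro B _ hchar
  obtain ⟨u, rfl⟩ := exists_unit_map_of_map_eigenvalue_eq (n := n) (A := A) (B := B)
    (circulantEigenvalue.map_univ_eq_of_charpoly_eq hchar) fun i hi hiA => by
      rw [hn]
      refine Nat.Coprime.prod_right fun l _ => Nat.Coprime.pow_right _ ?_
      have hl : p ⟨0, hs⟩ ≤ p l := hmono.monotone (Fin.mk_le_of_le_val (Nat.zero_le _))
      exact (Nat.coprime_of_lt_prime hi.ne' (hiA.trans_le (hAm.trans_le (hm.trans hl))) (hp l)).symm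
  exact ⟨u⁻¹.mulLeft, circulantAdj_map_unit_mul u⟩
end

section
/- Let p be an odd prime, let r ≥ 2 be an integer, and let n = 2^r·p. Define subsets of ℤ/nℤ by A = {1 + i·2^r : 0 ≤ i ≤ (p−1)/2} ∪ {1 + j·2^r + n/2 : 1 ≤ j ≤ (p−1)/2} and B = {1 − i·2^r : 0 ≤ i ≤ (p−1)/2} ∪ {1 − j·2^r + n/2 : 1 ≤ j ≤ (p−1)/2}. Then the circulant graphs X = Cay(ℤ/nℤ, A) and Y = Cay(ℤ/nℤ, B) are isospectral but not isomorphic. -/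
/-- Adjacency matrix of the circulant graph `Cay(ℤ/nℤ, S)` with connection set `S`:
the `(u,v)` entry is `1` if `v - u ∈ S` and `0` otherwise. -/
def circulantAdjSet (n : ℕ) [NeZero n] (S : Finset (ZMod n)) :
    Matrix (ZMod n) (ZMod n) ℂ :=
  Matrix.of fun u v => if v - u ∈ S then 1 else 0

/-- The connection set `A = {1 + i·2^r : 0 ≤ i ≤ (p−1)/2} ∪ {1 + j·2^r + n/2 : 1 ≤ j ≤ (p−1)/2}`
in `ℤ/nℤ`, `n = 2^r·p`. -/
def connA (n r p : ℕ) : Finset (ZMod n) :=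
  ((Finset.range ((p - 1) / 2 + 1)).image fun i => ((1 + i * 2 ^ r : ℕ) : ZMod n)) ∪
  ((Finset.Icc 1 ((p - 1) / 2)).image fun j => ((1 + j * 2 ^ r + n / 2 : ℕ) : ZMod n))

/-- The connection set `B = {1 − i·2^r : 0 ≤ i ≤ (p−1)/2} ∪ {1 − j·2^r + n/2 : 1 ≤ j ≤ (p−1)/2}`
in `ℤ/nℤ`, `n = 2^r·p`. -/
def connB (n r p : ℕ) : Finset (ZMod n) :=
  ((Finset.range ((p - 1) / 2 + 1)).image fun i => (1 - (i * 2 ^ r : ℕ) : ZMod n)) ∪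
  ((Finset.Icc 1 ((p - 1) / 2)).image fun j =>
    (1 - (j * 2 ^ r : ℕ) + (n / 2 : ℕ) : ZMod n))

open Finset

/-- The multiset of eigenvalues of a circulant matrix consists of the character sums over
its connection set. -/
lemma circulantAdjSet_charpoly (n : ℕ) [NeZero n] (S : Finset (ZMod n)) :
    (circulantAdjSet n S).charpoly =
      ∏ k : ZMod n, (Polynomial.X - Polynomial.C (∑ s ∈ S, ZMod.stdAddChar (s * k))) := by
  set F : Matrix (ZMod n) (ZMod n) ℂ := Matrix.of fun u k => ZMod.stdAddChar (u * k) with hF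
  set G : Matrix (ZMod n) (ZMod n) ℂ :=
    Matrix.of fun k u => (n : ℂ)⁻¹ * ZMod.stdAddChar (-(k * u)) with hG
  set D : Matrix (ZMod n) (ZMod n) ℂ :=
    Matrix.diagonal fun k => ∑ s ∈ S, ZMod.stdAddChar (s * k) with hD
  have hn0 : (n : ℂ) ≠ 0 := Nat.cast_ne_zero.mpr (NeZero.ne n)
  have hFG : F * G = 1 := by
    ext u v
    have h1 := AddChar.sum_mulShift (u - v) (ZMod.isPrimitive_stdAddChar n)
    have h2 : (F * G) u v = (n : ℂ)⁻¹ * ∑ k : ZMod n, ZMod.stdAddChar (k * (u - v)) := by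
      rw [Matrix.mul_apply, mul_sum]
      refine sum_congr rfl fun k _ => ?_
      simp only [hF, hG, Matrix.of_apply]
      rw [mul_left_comm, ← AddChar.map_add_eq_mul]
      ring_nf
    rw [h2, h1, Matrix.one_apply, ZMod.card]
    by_cases huv : u = v
    · simp [huv, hn0]
    · simp [huv, sub_eq_zero]
  have hMF : circulantAdjSet n S * F = F * D := by
    ext u k
    rw [hD, Matrix.mul_diagonal, Matrix.mul_apply, mul_sum]
    simp only [circulantAdjSet, hF, Matrix.of_apply, ite_mul, one_mul, zero_mul]
    rw [← Equiv.sum_comp (Equiv.addLeft u)]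
    simp only [Equiv.coe_addLeft, add_sub_cancel_left]
    rw [sum_ite_mem, univ_inter]
    refine sum_congr rfl fun s _ => ?_
    rw [← AddChar.map_add_eq_mul, add_mul]
  have hM : circulantAdjSet n S = F * (D * G) := by
    rw [← mul_assoc, ← hMF, mul_assoc, hFG, mul_one]
  rw [hM, Matrix.charpoly_mul_comm, mul_assoc, mul_eq_one_comm.mp hFG, mul_one, hD,
    Matrix.charpoly_diagonal]

/-- The connection set `{1 + i·g : 0 ≤ i ≤ m} ∪ {1 + j·g + h : 1 ≤ j ≤ m}`. -/
def stepConn {R : Type*} [Ring R] [DecidableEq R] (g h : R) (m : ℕ) : Finset R :=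
  ((range (m + 1)).image fun i : ℕ => 1 + (i : R) * g) ∪
  ((Icc 1 m).image fun j : ℕ => 1 + (j : R) * g + h)

/-- The elements `g` and `h` of a commutative ring generate an internal direct sum of a group
of order `2 * m + 1` and a group of order `2`, and both are annihilated by `h`. -/
structure IsStepPair {R : Type*} [CommRing R] (g h : R) (m : ℕ) : Prop where
  dvd_of_eq_zero : ∀ k ε : ℤ, (k : R) * g + (ε : R) * h = 0 →
    (2 : ℤ) ∣ ε ∧ (2 * m + 1 : ℤ) ∣ k
  h_add_h : h + h = 0
  g_mul_h : g * h = 0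
  h_mul_h : h * h = 0
  order_mul_g : ((2 * m + 1 : ℕ) : R) * g = 0

section stepConn

variable {R : Type*} [CommRing R] {g h : R} {m : ℕ}

lemma IsStepPair.neg (H : IsStepPair g h m) : IsStepPair (-g) h m where
  dvd_of_eq_zero k ε hk := by
    have := H.dvd_of_eq_zero (-k) ε (by push_cast; linear_combination hk)
    exact ⟨this.1, (dvd_neg).mp this.2⟩
  h_add_h := H.h_add_h
  g_mul_h := by rw [neg_mul, H.g_mul_h, neg_zero]
  h_mul_h := H.h_mul_h
  order_mul_g := by rw [mul_neg, H.order_mul_g, neg_zero]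

variable [DecidableEq R]

lemma mem_stepConn {x : R} : x ∈ stepConn g h m ↔
    ∃ k ε : ℤ, 0 ≤ k ∧ k ≤ m ∧ (ε = 0 ∨ ε = 1 ∧ 1 ≤ k) ∧ x = 1 + (k : R) * g + (ε : R) * h := by
  simp only [stepConn, mem_union, mem_image, mem_range, mem_Icc]
  constructor
  · rintro (⟨i, hi, rfl⟩ | ⟨j, hj, rfl⟩)
    · exact ⟨i, 0, by omega, by omega, by omega, by simp⟩
    · exact ⟨j, 1, by omega, by omega, by omega, by simp⟩
  · rintro ⟨k, ε, h0, h1, h2, rfl⟩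
    lift k to ℕ using h0
    rcases h2 with rfl | ⟨rfl, h2⟩
    · exact Or.inl ⟨k, by omega, by simp⟩
    · exact Or.inr ⟨k, by omega, by simp⟩

lemma IsStepPair.mem_iff (H : IsStepPair g h m) {k ε : ℤ} (hk : -m ≤ k) (hk' : k ≤ 2 * m) :
    1 + (k : R) * g + (ε : R) * h ∈ stepConn g h m ↔
      0 ≤ k ∧ k ≤ m ∧ (2 ∣ ε ∨ 1 ≤ k) := by
  rw [mem_stepConn]
  constructor
  · rintro ⟨k', ε', h0, h1, h2, he⟩
    obtain ⟨ha, hb⟩ := H.dvd_of_eq_zero (k - k') (ε - ε') (by push_cast; linear_combination he)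
    have hkk : k - k' = 0 := Int.eq_zero_of_abs_lt_dvd hb (by rw [abs_lt]; omega)
    omega
  · rintro ⟨h0, h1, h2⟩
    have key : ∃ c ε' : ℤ, ε = ε' + 2 * c ∧ (ε' = 0 ∨ ε' = 1 ∧ 1 ≤ k) := by
      refine ⟨ε / 2, ε % 2, by omega, by omega⟩
    obtain ⟨c, ε', rfl, h3⟩ := key
    refine ⟨k, ε', h0, h1, h3, ?_⟩
    push_cast
    linear_combination (c : R) * H.h_add_h

lemma IsStepPair.sum_stepConn (H : IsStepPair g h m) (f : R → ℂ) :
    ∑ s ∈ stepConn g h m, f s =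
      ∑ i ∈ range (m + 1), f (1 + (i : R) * g) + ∑ j ∈ Icc 1 m, f (1 + (j : R) * g + h) := by
  have inj : ∀ i j : ℕ, i ≤ m → j ≤ m → (i : R) * g = (j : R) * g → i = j := by
    intro i j hi hj hij
    obtain ⟨-, hb⟩ := H.dvd_of_eq_zero (i - j) 0 (by push_cast; linear_combination hij)
    have := Int.eq_zero_of_abs_lt_dvd hb (by rw [abs_lt]; omega)
    omega
  rw [stepConn, sum_union, sum_image, sum_image]
  · intro i hi j hj hij
    simp only [coe_Icc, Set.mem_Icc] at hi hj
    exact inj i j hi.2 hj.2 (by linear_combination hij)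
  · intro i hi j hj hij
    simp only [coe_range, Set.mem_Iio] at hi hj
    exact inj i j (by omega) (by omega) (by linear_combination hij)
  · rw [disjoint_left]
    simp only [mem_image]
    rintro _ ⟨i, -, rfl⟩ ⟨j, -, hij⟩
    have := (H.dvd_of_eq_zero (j - i) 1 (by push_cast; linear_combination hij)).1
    omega

/-- The only element of the connection set which leaves it under translation by `h` is `1`. -/
lemma IsStepPair.sdiff_translate (H : IsStepPair g h m) (x : R) :
    (x ∈ stepConn g h m ∧ x - h ∉ stepConn g h m) ↔ x = 1 := by
  have shift : ∀ k ε : ℤ, (1 + (k : R) * g + (ε : R) * h) - h =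
      1 + (k : R) * g + ((ε - 1 : ℤ) : R) * h := by
    intro k ε; push_cast; ring
  constructor
  · rintro ⟨hx, hx'⟩
    obtain ⟨k, ε, h0, h1, h2, rfl⟩ := mem_stepConn.mp hx
    rw [shift, H.mem_iff (by omega) (by omega)] at hx'
    obtain rfl : k = 0 := by omega
    obtain rfl : ε = 0 := by omega
    simp
  · rintro rfl
    have e : (1 : R) = 1 + ((0 : ℤ) : R) * g + ((0 : ℤ) : R) * h := by simp
    rw [e, shift, H.mem_iff (by omega) (by omega), H.mem_iff (by omega) (by omega)]
    omega

/-- If a nonzero translation moves exactly one element of the connection set out of it,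
that element is `1`. -/
lemma IsStepPair.eq_one_of_sdiff_translate (H : IsStepPair g h m) (hm : 1 ≤ m) {a d : R}
    (hd : d ≠ 0) (hA : ∀ x, (x ∈ stepConn g h m ∧ x - d ∉ stepConn g h m) ↔ x = a) :
    a = 1 := by
  have mem : ∀ k ε : ℤ, 0 ≤ k → k ≤ m → (2 ∣ ε ∨ 1 ≤ k) →
      1 + (k : R) * g + (ε : R) * h ∈ stepConn g h m := fun k ε h0 h1 h2 =>
    (H.mem_iff (by omega) (by omega)).mpr ⟨h0, h1, h2⟩
  have shift : ∀ k ε t δ : ℤ, (1 + (k : R) * g + (ε : R) * h) - ((t : R) * g + (δ : R) * h) =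
      1 + ((k - t : ℤ) : R) * g + ((ε - δ : ℤ) : R) * h := by
    intro k ε t δ; push_cast; ring
  have differ : ∀ k ε k' ε' : ℤ, 1 + (k : R) * g + (ε : R) * h ∈ stepConn g h m →
      1 + (k : R) * g + (ε : R) * h - d ∉ stepConn g h m →
      1 + (k' : R) * g + (ε' : R) * h ∈ stepConn g h m →
      1 + (k' : R) * g + (ε' : R) * h - d ∉ stepConn g h m →
      (2 : ℤ) ∣ ε - ε' ∧ (2 * m + 1 : ℤ) ∣ k - k' := by
    intro k ε k' ε' h1 h2 h3 h4
    have e1 := (hA _).mp ⟨h1, h2⟩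
    have e2 := (hA _).mp ⟨h3, h4⟩
    exact H.dvd_of_eq_zero _ _ (by push_cast; linear_combination e1 - e2)
  have hdA : ∃ t δ : ℤ, -m ≤ t ∧ t ≤ m ∧ d = (t : R) * g + (δ : R) * h := by
    by_contra hcon
    have out : ∀ k ε : ℤ, 0 ≤ k → k ≤ m → (2 ∣ ε ∨ 1 ≤ k) →
        1 + (k : R) * g + (ε : R) * h - d ∉ stepConn g h m := by
      intro k ε h0 h1 _ hmem
      obtain ⟨k', ε', h0', h1', -, he⟩ := mem_stepConn.mp hmem
      exact hcon ⟨k - k', ε - ε', by omega, by omega, by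
        push_cast; linear_combination -he⟩
    have := (differ 1 0 1 1 (mem _ _ (by omega) (by omega) (by omega))
      (out _ _ (by omega) (by omega) (by omega)) (mem _ _ (by omega) (by omega) (by omega))
      (out _ _ (by omega) (by omega) (by omega))).1
    omega
  obtain ⟨t, δ, ht, ht', rfl⟩ := hdA
  have out : ∀ k ε : ℤ, -m ≤ k - t → k - t ≤ 2 * m →
      ¬ (0 ≤ k - t ∧ k - t ≤ m ∧ (2 ∣ ε - δ ∨ 1 ≤ k - t)) →
      1 + (k : R) * g + (ε : R) * h - ((t : R) * g + (δ : R) * h) ∉ stepConn g h m := by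
    intro k ε h0 h1 h2
    rwa [shift, H.mem_iff h0 h1]
  have small : ∀ k k' : ℤ, 0 ≤ k → k ≤ m → 0 ≤ k' → k' ≤ m → (2 * m + 1 : ℤ) ∣ k - k' →
      k = k' := by
    intro k k' h0 h1 h2 h3 hb
    have := Int.eq_zero_of_abs_lt_dvd hb (by rw [abs_lt]; omega)
    omega
  rcases lt_trichotomy t 0 with h0 | rfl | h0
  · have := (differ m 0 m 1 (mem _ _ (by omega) (by omega) (by omega))
      (out _ _ (by omega) (by omega) (by omega)) (mem _ _ (by omega) (by omega) (by omega))
      (out _ _ (by omega) (by omega) (by omega))).1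
    omega
  · have hδ : δ % 2 = 1 := by
      by_contra hδ
      obtain ⟨c, rfl⟩ : (2 : ℤ) ∣ δ := by omega
      exact hd (by push_cast; linear_combination (c : R) * H.h_add_h)
    refine (hA 1).mp ?_ |>.symm
    have e : (1 : R) = 1 + ((0 : ℤ) : R) * g + ((0 : ℤ) : R) * h := by simp
    rw [e]
    exact ⟨mem _ _ (by omega) (by omega) (by omega), out _ _ (by omega) (by omega) (by omega)⟩
  · have := small _ _ (by omega) (by omega) (by omega) (by omega)
      (differ 0 0 1 (δ + 1) (mem _ _ (by omega) (by omega) (by omega))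
      (out _ _ (by omega) (by omega) (by omega)) (mem _ _ (by omega) (by omega) (by omega))
      (out _ _ (by omega) (by omega) (by omega))).2
    omega

lemma IsStepPair.one_sub_notMem (H : IsStepPair g h m) (hm : 1 ≤ m) :
    1 - g ∉ stepConn g h m := by
  have e : 1 - g = 1 + ((-1 : ℤ) : R) * g + ((0 : ℤ) : R) * h := by push_cast; ring
  rw [e, H.mem_iff (by omega) (by omega)]
  omega

lemma IsStepPair.one_add_mem (H : IsStepPair g h m) (hm : 1 ≤ m) :
    1 + g ∈ stepConn g h m := by
  have e : 1 + g = 1 + ((1 : ℤ) : R) * g + ((0 : ℤ) : R) * h := by push_cast; ring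
  rw [e, H.mem_iff (by omega) (by omega)]
  omega

/-- The character sums over the connection set. -/
lemma IsStepPair.sum_addChar (H : IsStepPair g h m) (ψ : AddChar R ℂ) (k : R) :
    ∑ s ∈ stepConn g h m, ψ (s * k) =
      ψ k * (1 + (1 + ψ (h * k)) * ∑ j ∈ Icc 1 m, ψ (g * k) ^ j) := by
  rw [H.sum_stepConn, range_eq_Ico, sum_eq_sum_Ico_succ_bot (by omega), zero_add,
    Ico_add_one_right_eq_Icc]
  have h1 : ∀ j : ℕ, ψ ((1 + (j : R) * g) * k) = ψ k * ψ (g * k) ^ j := by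
    intro j
    rw [← AddChar.map_nsmul_eq_pow, ← AddChar.map_add_eq_mul, nsmul_eq_mul]
    ring_nf
  have h2 : ∀ j : ℕ, ψ ((1 + (j : R) * g + h) * k) = ψ k * ψ (h * k) * ψ (g * k) ^ j := by
    intro j
    rw [add_mul, AddChar.map_add_eq_mul, h1]
    ring
  simp_rw [h1, h2, ← mul_sum]
  ring

lemma one_add_sum_pow_add_sum_inv_pow {z : ℂ} (hz : z ^ (2 * m + 1) = 1) (hz1 : z ≠ 1) :
    1 + ∑ j ∈ Icc 1 m, z ^ j + ∑ j ∈ Icc 1 m, z⁻¹ ^ j = 0 := by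
  have hz0 : z ≠ 0 := by rintro rfl; simp at hz
  have hgeom : ∑ j ∈ range (2 * m + 1), z ^ j = 0 := by
    rw [geom_sum_eq hz1, hz, sub_self, zero_div]
  rw [range_eq_Ico, sum_eq_sum_Ico_succ_bot (by omega),
    ← sum_Ico_consecutive _ (show 0 + 1 ≤ m + 1 by omega) (by omega)] at hgeom
  have hrefl : ∑ j ∈ Ico (m + 1) (2 * m + 1), z ^ j = ∑ j ∈ Icc 1 m, z⁻¹ ^ j := by
    refine sum_bij' (fun j _ => 2 * m + 1 - j) (fun j _ => 2 * m + 1 - j) ?_ ?_ ?_ ?_ ?_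
    · intro j hj; rw [mem_Ico] at hj; rw [mem_Icc]; omega
    · intro j hj; rw [mem_Icc] at hj; rw [mem_Ico]; omega
    · intro j hj; rw [mem_Ico] at hj; omega
    · intro j hj; rw [mem_Icc] at hj; omega
    · intro j hj
      rw [mem_Ico] at hj
      rw [inv_pow]
      refine eq_inv_of_mul_eq_one_left ?_
      rw [← pow_add, ← hz]
      congr 1
      omega
  rw [hrefl, zero_add, pow_zero, Ico_add_one_right_eq_Icc, ← add_assoc] at hgeom
  exact hgeom

end stepConn

lemma circulantAdjSet_stepConn_charpoly (n : ℕ) [NeZero n] {g h : ZMod n} {m : ℕ}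
    (H : IsStepPair g h m) :
    (circulantAdjSet n (stepConn g h m)).charpoly =
      (circulantAdjSet n (stepConn (-g) h m)).charpoly := by
  classical
  set ψ : AddChar (ZMod n) ℂ := ZMod.stdAddChar with hψ
  have hh0 : h ≠ 0 := by
    rintro rfl
    have := (H.dvd_of_eq_zero 0 1 (by simp)).1
    omega
  have sq : ∀ k, ψ (h * k) = 1 ∨ ψ (h * k) = -1 := by
    intro k
    rw [← sq_eq_one_iff, pow_two, ← AddChar.map_add_eq_mul, ← add_mul, H.h_add_h, zero_mul,
      AddChar.map_zero_eq_one]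
  have hψh : ψ h = -1 := by
    have h1 := sq 1
    rw [mul_one] at h1
    refine h1.resolve_left fun h2 => hh0 ?_
    rw [← AddChar.map_zero_eq_one ψ] at h2
    exact ZMod.injective_stdAddChar h2
  have hgh : ∀ k, ψ (g * (k + h)) = ψ (g * k) := by
    intro k; rw [mul_add, H.g_mul_h, add_zero]
  have hhh : ∀ k, ψ (h * (k + h)) = ψ (h * k) := by
    intro k; rw [mul_add, H.h_mul_h, add_zero]
  set π : ZMod n → ZMod n := fun k =>
    if ψ (h * k) = 1 ∧ ψ (g * k) ≠ 1 then k + h else k with hπ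
  have hinv : Function.Involutive π := by
    intro k
    by_cases hk : ψ (h * k) = 1 ∧ ψ (g * k) ≠ 1
    · have : ψ (h * (k + h)) = 1 ∧ ψ (g * (k + h)) ≠ 1 := by rwa [hgh, hhh]
      simp only [hπ]
      rw [if_pos hk, if_pos this, add_assoc, H.h_add_h, add_zero]
    · simp only [hπ, if_neg hk]
  rw [circulantAdjSet_charpoly, circulantAdjSet_charpoly, ← Equiv.prod_comp hinv.toPerm]
  refine prod_congr rfl fun k _ => ?_
  congr 2
  rw [Function.Involutive.coe_toPerm, ← hψ, H.sum_addChar, H.neg.sum_addChar, neg_mul,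
    AddChar.map_neg_eq_inv]
  by_cases hk : ψ (h * k) = 1 ∧ ψ (g * k) ≠ 1
  · simp only [hπ]
    rw [if_pos hk, hgh, hhh, hk.1, AddChar.map_add_eq_mul, hψh]
    have hz : ψ (g * k) ^ (2 * m + 1) = 1 := by
      rw [← AddChar.map_nsmul_eq_pow, nsmul_eq_mul, ← mul_assoc, H.order_mul_g, zero_mul,
        AddChar.map_zero_eq_one]
    linear_combination (-2 * ψ k) * one_add_sum_pow_add_sum_inv_pow hz hk.2
  · simp only [hπ, if_neg hk]
    rcases sq k with h1 | h1
    · have hz : ψ (g * k) = 1 := by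
        by_contra hz
        exact hk ⟨h1, hz⟩
      rw [hz, inv_one]
    · rw [h1]; ring

lemma circulantAdjSet_stepConn_not_iso (n : ℕ) [NeZero n] {g h : ZMod n} {m : ℕ}
    (H : IsStepPair g h m) (hm : 1 ≤ m) :
    ¬ ∃ e : Equiv.Perm (ZMod n), circulantAdjSet n (stepConn (-g) h m) =
      (circulantAdjSet n (stepConn g h m)).submatrix e e := by
  rintro ⟨e, he⟩
  have hmem : ∀ u v, v - u ∈ stepConn (-g) h m ↔ e v - e u ∈ stepConn g h m := by
    intro u v
    have h1 := congrFun (congrFun he u) v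
    simp only [circulantAdjSet, Matrix.submatrix_apply, Matrix.of_apply] at h1
    split_ifs at h1 <;> simp_all
  have hh0 : h ≠ 0 := by
    rintro rfl
    have := (H.dvd_of_eq_zero 0 1 (by simp)).1
    omega
  have hstep : ∀ u, e (u + 1) = e u + 1 := by
    intro u
    have key : e (u + 1) - e u = 1 := by
      refine H.eq_one_of_sdiff_translate hm (d := e (u + h) - e u) ?_ ?_
      · rw [sub_ne_zero, e.injective.ne_iff]
        simpa using hh0
      · intro x
        obtain ⟨y, hy⟩ := e.surjective (x + e u)
        obtain rfl : x = e y - e u := by rw [hy]; ring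
        rw [sub_sub_sub_cancel_right, ← hmem, ← hmem, sub_left_inj, e.injective.eq_iff,
          ← sub_sub, H.neg.sdiff_translate, sub_eq_iff_eq_add']
    exact sub_eq_iff_eq_add'.mp key
  have htrans : ∀ k : ℕ, e (k : ZMod n) = e 0 + k := by
    intro k
    induction k with
    | zero => simp
    | succ k ih => rw [Nat.cast_succ, hstep, ih, add_assoc]
  have hg := H.one_add_mem hm
  have h1 := htrans (1 + g).val
  rw [ZMod.natCast_zmod_val] at h1
  have h2 := (hmem 0 (1 + g)).mpr (by rw [h1]; simpa using hg)
  refine H.neg.one_sub_notMem hm ?_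
  simpa using h2

lemma isStepPair_two_pow (q m : ℕ) (hq : 1 ≤ q) :
    IsStepPair (R := ZMod (2 ^ (q + 1) * (2 * m + 1)))
      (2 ^ (q + 1)) (2 ^ q * (2 * m + 1)) m where
  dvd_of_eq_zero k ε hk := by
    have h1 : ((k * 2 ^ (q + 1) + ε * (2 ^ q * (2 * m + 1)) : ℤ) :
        ZMod (2 ^ (q + 1) * (2 * m + 1))) = 0 := by
      push_cast; exact hk
    rw [ZMod.intCast_zmod_eq_zero_iff_dvd] at h1
    obtain ⟨c, hc⟩ := h1
    push_cast at hc
    have h2 : 2 * k + ε * (2 * m + 1) = 2 * (2 * m + 1) * c := by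
      refine mul_left_cancel₀ (pow_ne_zero q (two_ne_zero (α := ℤ))) ?_
      linear_combination hc
    constructor
    · exact ⟨(2 * m + 1) * c - k - ε * m, by linear_combination h2⟩
    · exact ⟨k - m * (2 * c - ε), by linear_combination (-m : ℤ) * h2⟩
  h_add_h := by
    have := ZMod.natCast_self (2 ^ (q + 1) * (2 * m + 1))
    push_cast at this
    linear_combination this
  g_mul_h := by
    have := ZMod.natCast_self (2 ^ (q + 1) * (2 * m + 1))
    push_cast at this
    linear_combination (2 ^ q) * this
  h_mul_h := by
    have := ZMod.natCast_self (2 ^ (q + 1) * (2 * m + 1))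
    push_cast at this
    obtain ⟨s, rfl⟩ := Nat.exists_eq_add_of_le' hq
    linear_combination (2 ^ s * (2 * m + 1)) * this
  order_mul_g := by
    have := ZMod.natCast_self (2 ^ (q + 1) * (2 * m + 1))
    push_cast at this ⊢
    linear_combination this

/-- For `n = 2^r·p` with `p` an odd prime and `r ≥ 2`, the circulant graphs
`X = Cay(ℤ/nℤ, A)` and `Y = Cay(ℤ/nℤ, B)` are isospectral (equal characteristic
polynomials of their adjacency matrices) but not isomorphic (not conjugate by any
permutation matrix). -/
theorem construction_isospectral_nonisomorphic (p r : ℕ) (hp : p.Prime)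
    (hodd : Odd p) (hr : 2 ≤ r) (n : ℕ) [NeZero n] (hn : n = 2 ^ r * p) :
    (circulantAdjSet n (connA n r p)).charpoly =
        (circulantAdjSet n (connB n r p)).charpoly ∧
    ¬ ∃ e : Equiv.Perm (ZMod n),
        circulantAdjSet n (connB n r p) =
          (circulantAdjSet n (connA n r p)).submatrix e e := by
  obtain ⟨m, rfl⟩ := hodd
  obtain ⟨q, rfl⟩ : ∃ q, r = q + 1 := ⟨r - 1, by omega⟩
  subst hn
  have hm : 1 ≤ m := by
    have := hp.two_le
    omega
  have H := isStepPair_two_pow q m (by omega)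
  have hhalf : 2 ^ (q + 1) * (2 * m + 1) / 2 = 2 ^ q * (2 * m + 1) := by
    rw [pow_succ, mul_right_comm, Nat.mul_div_cancel _ two_pos]
  have hm' : (2 * m + 1 - 1) / 2 = m := by omega
  have hA : connA (2 ^ (q + 1) * (2 * m + 1)) (q + 1) (2 * m + 1) =
      stepConn (R := ZMod (2 ^ (q + 1) * (2 * m + 1)))
         (2 ^ (q + 1)) (2 ^ q * (2 * m + 1)) m := by
    simp only [connA, stepConn, hhalf, hm']
    push_cast
    rfl
  have hB : connB (2 ^ (q + 1) * (2 * m + 1)) (q + 1) (2 * m + 1) =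
      stepConn (R := ZMod (2 ^ (q + 1) * (2 * m + 1)))
         (-2 ^ (q + 1)) (2 ^ q * (2 * m + 1)) m := by
    simp only [connB, stepConn, hhalf, hm', mul_neg, ← sub_eq_add_neg]
    push_cast
    rfl
  rw [hA, hB]
  exact ⟨circulantAdjSet_stepConn_charpoly _ H, circulantAdjSet_stepConn_not_iso _ H hm⟩
end

section
/- Let p be an odd prime, let r ≥ 2 be an integer, let n = 2^r·p, and let q be an integer with gcd(q, n) = 1. Define A = {1 + i·2^r : 0 ≤ i ≤ (p−1)/2} ∪ {1 + j·2^r + n/2 : 1 ≤ j ≤ (p−1)/2} and B = {1 − i·2^r : 0 ≤ i ≤ (p−1)/2} ∪ {1 − j·2^r + n/2 : 1 ≤ j ≤ (p−1)/2} as subsets of ℤ/nℤ, and let Ã and B̃ be the multiset unions A ⊎ q·A and B ⊎ q·B respectively (where q·A = {q·a : a ∈ A} counted with multiplicity). Then the circulant multigraphs X̃ = Cay(ℤ/nℤ, Ã) and Ỹ = Cay(ℤ/nℤ, B̃) are isospectral. -/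
open AddChar

/-- The eigenvalues of a circulant multigraph are the character sums over its connection
multiset. -/
theorem circulantAdj_charpoly {n : ℕ} [NeZero n] (ψ : AddChar (ZMod n) ℂ) (hψ : ψ.IsPrimitive)
    (S : Multiset (ZMod n)) :
    (circulantAdj n S).charpoly =
      ∏ k : ZMod n, (Polynomial.X - Polynomial.C (S.map fun s => ψ (s * k)).sum) := by
  set V : Matrix (ZMod n) (ZMod n) ℂ := Matrix.of fun j k => ψ (j * k) with hV
  set W : Matrix (ZMod n) (ZMod n) ℂ := Matrix.of fun j k => (n : ℂ)⁻¹ * ψ (-(j * k)) with hW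
  set d : ZMod n → ℂ := fun k => (S.map fun s => ψ (s * k)).sum with hd
  have hn : (n : ℂ) ≠ 0 := NeZero.ne _
  have hVW : V * W = 1 := by
    ext i k
    have h : ∀ j, V i j * W j k = (n : ℂ)⁻¹ * ψ (j * (i - k)) := fun j => by
      rw [show j * (i - k) = i * j + -(j * k) by ring, map_add_eq_mul]
      simp only [hV, hW, Matrix.of_apply]
      ring
    rw [Matrix.mul_apply, Finset.sum_congr rfl fun j _ => h j, ← Finset.mul_sum,
      sum_mulShift _ hψ, Matrix.one_apply]
    simp only [sub_eq_zero, ZMod.card]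
    split_ifs <;> simp [hn]
  have hWV : W * V = 1 := mul_eq_one_comm.mp hVW
  have hMV : circulantAdj n S * V = V * Matrix.diagonal d := by
    ext u k
    rw [Matrix.mul_diagonal, Matrix.mul_apply, ← Equiv.sum_comp (Equiv.addRight u)]
    simp only [circulantAdj, hV, hd, Matrix.of_apply, Equiv.coe_addRight, add_sub_cancel_right,
      add_mul, map_add_eq_mul]
    rw [Finset.sum_multiset_map_count, Finset.mul_sum,
      ← Finset.sum_subset (Finset.subset_univ S.toFinset)]
    · refine Finset.sum_congr rfl fun s _ => ?_
      rw [nsmul_eq_mul]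
      ring
    · intro s _ hs
      rw [Multiset.count_eq_zero.mpr (by simpa using hs)]
      simp
  have hM : circulantAdj n S = V * Matrix.diagonal d * W := by
    rw [← hMV, mul_assoc, hVW, mul_one]
  rw [hM, Matrix.charpoly_mul_comm, ← mul_assoc, hWV, one_mul, Matrix.charpoly_diagonal]

section ConnectionSets

variable {n r p : ℕ}

theorem two_mul_half_eq_zero (hr : 2 ≤ r) (hn : n = 2 ^ r * p) :
    (2 : ZMod n) * ((n / 2 : ℕ) : ZMod n) = 0 := by
  have h : 2 * (n / 2) = n := Nat.mul_div_cancel' (hn ▸ (dvd_pow_self 2 (by omega)).mul_right p)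
  exact_mod_cast (congrArg (Nat.cast : ℕ → ZMod n) h).trans (ZMod.natCast_self n)

theorem half_ne_zero [NeZero n] (hr : 2 ≤ r) (hn : n = 2 ^ r * p) : ((n / 2 : ℕ) : ZMod n) ≠ 0 := by
  have h : 2 * (n / 2) = n := Nat.mul_div_cancel' (hn ▸ (dvd_pow_self 2 (by omega)).mul_right p)
  have h0 := NeZero.ne n
  rw [Ne, ZMod.natCast_eq_zero_iff]
  intro hdvd
  have := Nat.le_of_dvd (by omega) hdvd
  omega

theorem natCast_mul_half (hr : 2 ≤ r) (hn : n = 2 ^ r * p) (a : ℕ) :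
    (a : ZMod n) * ((n / 2 : ℕ) : ZMod n) = if Even a then 0 else ((n / 2 : ℕ) : ZMod n) := by
  have h2 := two_mul_half_eq_zero hr hn
  split_ifs with ha
  · obtain ⟨b, rfl⟩ := even_iff_exists_two_mul.mp ha
    push_cast
    linear_combination (b : ZMod n) * h2
  · obtain ⟨b, rfl⟩ := Nat.not_even_iff_odd.mp ha
    push_cast at h2 ⊢
    linear_combination (b : ZMod n) * h2

theorem half_mul_half (hr : 2 ≤ r) (hn : n = 2 ^ r * p) :
    ((n / 2 : ℕ) : ZMod n) * ((n / 2 : ℕ) : ZMod n) = 0 := by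
  rw [natCast_mul_half hr hn, if_pos]
  obtain ⟨s, rfl⟩ := Nat.exists_eq_add_of_le hr
  have h : n / 2 = 2 * (2 ^ s * p) := by
    rw [hn, pow_add]
    exact Nat.div_eq_of_eq_mul_right two_pos (by ring)
  exact h ▸ even_two_mul _

theorem two_pow_mul_half (hr : 2 ≤ r) (hn : n = 2 ^ r * p) :
    ((2 ^ r : ℕ) : ZMod n) * ((n / 2 : ℕ) : ZMod n) = 0 := by
  rw [natCast_mul_half hr hn, if_pos]
  exact even_iff_two_dvd.mpr (dvd_pow_self 2 (by omega))

theorem two_pow_mul_natCast_eq_zero (hn : n = 2 ^ r * p) :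
    ((2 ^ r : ℕ) : ZMod n) * (p : ZMod n) = 0 := by
  rw [← Nat.cast_mul, ← hn, ZMod.natCast_self]

theorem injOn_natCast_mul_two_pow (hn : n = 2 ^ r * p) :
    Set.InjOn (fun i : ℕ => ((i * 2 ^ r : ℕ) : ZMod n)) (Set.Iio p) := by
  have hlt : ∀ i < p, i * 2 ^ r < n := fun i hi => by
    rw [hn, mul_comm]
    exact Nat.mul_lt_mul_of_pos_left hi (by positivity)
  intro i hi j hj hij
  have h := (ZMod.natCast_eq_natCast_iff _ _ _).mp hij
  exact Nat.eq_of_mul_eq_mul_right (by positivity)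
    (Nat.ModEq.eq_of_lt_of_lt h (hlt i hi) (hlt j hj))

theorem sum_connA [NeZero n] {M : Type*} [AddCommMonoid M] (hp : Odd p) (hr : 2 ≤ r) (hn : n = 2 ^ r * p)
    (f : ZMod n → M) :
    ∑ a ∈ connA n r p, f a =
      f 1 + ∑ j ∈ Finset.range ((p - 1) / 2),
        (f (1 + ((j + 1 : ℕ) : ZMod n) * (2 ^ r : ℕ)) +
          f (1 + ((j + 1 : ℕ) : ZMod n) * (2 ^ r : ℕ) + (n / 2 : ℕ))) := by
  have hp0 := hp.pos
  have hinj := injOn_natCast_mul_two_pow hn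
  have hpt := two_pow_mul_natCast_eq_zero hn
  have hpm : (p : ZMod n) * ((n / 2 : ℕ) : ZMod n) = ((n / 2 : ℕ) : ZMod n) := by
    rw [natCast_mul_half hr hn, if_neg (Nat.not_even_iff_odd.mpr hp)]
  rw [connA, Finset.sum_union, Finset.sum_image, Finset.sum_image, Finset.sum_range_succ',
    ← Finset.Ico_add_one_right_eq_Icc, Finset.sum_Ico_eq_sum_range, Finset.sum_add_distrib,
    add_comm (Finset.sum _ _) (f _), add_assoc]
  · push_cast
    simp [add_comm (1 : ZMod n), add_assoc, add_left_comm]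
  · intro i hi j hj hij
    simp only [Finset.coe_Icc, Set.mem_Icc] at hi hj
    refine hinj (show i < p by omega) (show j < p by omega) ?_
    push_cast at hij ⊢
    linear_combination hij
  · intro i hi j hj hij
    simp only [Finset.coe_range, Set.mem_Iio] at hi hj
    refine hinj (show i < p by omega) (show j < p by omega) ?_
    push_cast at hij ⊢
    linear_combination hij
  · rw [Finset.disjoint_left]
    intro a ha hb
    obtain ⟨i, -, rfl⟩ := Finset.mem_image.mp ha
    obtain ⟨j, -, hij⟩ := Finset.mem_image.mp hb
    refine half_ne_zero hr hn ?_
    push_cast at hij hpt hpm ⊢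
    linear_combination (p : ZMod n) * hij - hpm + ((i : ZMod n) - j) * hpt

theorem connB_eq_image_connA (hr : 2 ≤ r) (hn : n = 2 ^ r * p) :
    connB n r p = (connA n r p).image fun a => 2 - a := by
  have h2 := two_mul_half_eq_zero hr hn
  rw [connA, connB, Finset.image_union, Finset.image_image, Finset.image_image]
  congr 1
  · refine Finset.image_congr fun i _ => ?_
    simp only [Function.comp_apply]
    push_cast
    ring
  · refine Finset.image_congr fun j _ => ?_
    simp only [Function.comp_apply]
    push_cast at h2 ⊢
    linear_combination h2

theorem sum_connA_char [NeZero n] (ψ : AddChar (ZMod n) ℂ) (hp : Odd p) (hr : 2 ≤ r) (hn : n = 2 ^ r * p)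
    (k : ZMod n) :
    ∑ a ∈ connA n r p, ψ (a * k) =
      ψ k * (1 + (1 + ψ ((n / 2 : ℕ) * k)) *
        ∑ j ∈ Finset.range ((p - 1) / 2), ψ ((2 ^ r : ℕ) * k) ^ (j + 1)) := by
  rw [sum_connA hp hr hn, one_mul, mul_add, mul_one, Finset.mul_sum, Finset.mul_sum]
  congr 1
  refine Finset.sum_congr rfl fun j _ => ?_
  rw [← map_nsmul_eq_pow, nsmul_eq_mul]
  simp only [add_mul, one_mul, map_add_eq_mul, mul_assoc]
  ring

theorem sum_connB_char [NeZero n] (ψ : AddChar (ZMod n) ℂ) (hp : Odd p) (hr : 2 ≤ r) (hn : n = 2 ^ r * p)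
    (k : ZMod n) :
    ∑ b ∈ connB n r p, ψ (b * k) =
      ψ k * (1 + (1 + ψ ((n / 2 : ℕ) * k)) *
        ∑ j ∈ Finset.range ((p - 1) / 2), (ψ ((2 ^ r : ℕ) * k))⁻¹ ^ (j + 1)) := by
  have h2 := two_mul_half_eq_zero hr hn
  have hneg : ((n / 2 : ℕ) : ZMod n) * -k = (n / 2 : ℕ) * k := by linear_combination -k * h2
  have hk : ψ k * ψ (-k) = 1 := by rw [← map_add_eq_mul, add_neg_cancel, map_zero_eq_one]
  have hsum : ∑ b ∈ connB n r p, ψ (b * k) = ψ k * ψ k * ∑ a ∈ connA n r p, ψ (a * -k) := by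
    rw [connB_eq_image_connA hr hn, Finset.sum_image fun a _ b _ h => sub_right_injective h,
      Finset.mul_sum]
    refine Finset.sum_congr rfl fun a _ => ?_
    rw [← map_add_eq_mul, ← map_add_eq_mul]
    congr 1
    ring
  rw [hsum, sum_connA_char ψ hp hr hn, hneg, mul_neg, map_neg_eq_inv ψ (_ * k)]
  linear_combination (ψ k * (1 + (1 + ψ ((n / 2 : ℕ) * k)) *
    ∑ j ∈ Finset.range ((p - 1) / 2), (ψ ((2 ^ r : ℕ) * k))⁻¹ ^ (j + 1))) * hk

end ConnectionSets

/-- The nontrivial powers of a `p`-th root of unity `z ≠ 1`, paired with their inverses,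
sum to `-1`. -/
theorem sum_pow_add_sum_inv_pow {K : Type*} [Field K] {p : ℕ} (hp : Odd p) {z : K} (hz : z ^ p = 1)
    (hz1 : z ≠ 1) :
    ∑ j ∈ Finset.range ((p - 1) / 2), z ^ (j + 1) +
      ∑ j ∈ Finset.range ((p - 1) / 2), z⁻¹ ^ (j + 1) = -1 := by
  obtain ⟨h, rfl⟩ := hp
  have hz0 : z ≠ 0 := by
    rintro rfl
    simp at hz
  have hinv : ∑ j ∈ Finset.range h, z⁻¹ ^ (j + 1) = ∑ j ∈ Finset.range h, z ^ (h + j + 1) := by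
    rw [← Finset.sum_range_reflect]
    refine Finset.sum_congr rfl fun j hj => ?_
    have hj' := Finset.mem_range.mp hj
    rw [inv_pow, inv_eq_iff_eq_inv, eq_comm, inv_eq_iff_eq_inv, ← one_div,
      eq_div_iff (pow_ne_zero _ hz0), ← pow_add, ← hz]
    congr 1
    omega
  have hgeom : ∑ j ∈ Finset.range (2 * h + 1), z ^ j = 0 := by
    rw [geom_sum_eq hz1, hz, sub_self, zero_div]
  rw [Finset.sum_range_succ', two_mul, Finset.sum_range_add] at hgeom
  rw [show (2 * h + 1 - 1) / 2 = h by omega, hinv]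
  linear_combination hgeom

section Shift

variable {n r p : ℕ}

open Classical in
/-- The involution of the frequencies exchanging the spectra: translation by `n / 2` on the
even frequencies not divisible by `p`, written with `t = 2 ^ r`. -/
noncomputable def frequencyShift (n t : ℕ) (k : ZMod n) : ZMod n :=
  if ((n / 2 : ℕ) : ZMod n) * k = 0 ∧ (t : ZMod n) * k ≠ 0 then k + (n / 2 : ℕ) else k

theorem frequencyShift_involutive (hr : 2 ≤ r) (hn : n = 2 ^ r * p) :
    Function.Involutive (frequencyShift n (2 ^ r)) := by
  intro k
  have h2 := two_mul_half_eq_zero hr hn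
  by_cases hk : ((n / 2 : ℕ) : ZMod n) * k = 0 ∧ ((2 ^ r : ℕ) : ZMod n) * k ≠ 0
  · rw [frequencyShift, frequencyShift, if_pos hk, mul_add, mul_add, half_mul_half hr hn,
      two_pow_mul_half hr hn, add_zero, add_zero, if_pos hk]
    linear_combination h2
  · rw [frequencyShift, frequencyShift, if_neg hk, if_neg hk]

theorem mul_frequencyShift {q : ZMod n}
    (hq : IsUnit q) (hqm : q * (n / 2 : ℕ) = (n / 2 : ℕ)) (k : ZMod n) :
    q * frequencyShift n (2 ^ r) k = frequencyShift n (2 ^ r) (q * k) := by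
  simp only [frequencyShift, mul_left_comm _ q, hq.mul_right_eq_zero, ne_eq]
  split_ifs
  · rw [mul_add, hqm]
  · rfl

theorem sum_connA_frequencyShift [NeZero n] (ψ : AddChar (ZMod n) ℂ) (hψ : ψ.IsPrimitive)
    (hp : Odd p) (hr : 2 ≤ r) (hn : n = 2 ^ r * p) (k : ZMod n) :
    ∑ a ∈ connA n r p, ψ (a * frequencyShift n (2 ^ r) k) = ∑ b ∈ connB n r p, ψ (b * k) := by
  have hm0 := half_ne_zero hr hn
  have hψm : ψ (n / 2 : ℕ) = -1 := by
    refine (sq_eq_one_iff.mp ?_).resolve_left fun h => hm0 ((hψ.zmod_char_eq_one_iff n _).mp h)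
    rw [← map_nsmul_eq_pow, nsmul_eq_mul, Nat.cast_ofNat, two_mul_half_eq_zero hr hn,
      map_zero_eq_one]
  rw [sum_connA_char ψ hp hr hn, sum_connB_char ψ hp hr hn, frequencyShift]
  by_cases hmk : ((n / 2 : ℕ) : ZMod n) * k = 0
  · by_cases htk : ((2 ^ r : ℕ) : ZMod n) * k = 0
    · rw [if_neg fun h => h.2 htk, htk, map_zero_eq_one, inv_one]
    · rw [if_pos ⟨hmk, htk⟩, mul_add _ k, mul_add _ k, half_mul_half hr hn, two_pow_mul_half hr hn,
        add_zero, add_zero, hmk, map_zero_eq_one, map_add_eq_mul, hψm]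
      have hz : ψ ((2 ^ r : ℕ) * k) ^ p = 1 := by
        rw [← map_nsmul_eq_pow, nsmul_eq_mul, ← mul_assoc, mul_comm (p : ZMod n),
          two_pow_mul_natCast_eq_zero hn, zero_mul, map_zero_eq_one]
      have hz1 : ψ ((2 ^ r : ℕ) * k) ≠ 1 := fun h => htk ((hψ.zmod_char_eq_one_iff n _).mp h)
      linear_combination (-2 * ψ k) * sum_pow_add_sum_inv_pow hp hz hz1
  · have hmk' : ((n / 2 : ℕ) : ZMod n) * k = (n / 2 : ℕ) := by
      have h := natCast_mul_half hr hn k.val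
      rw [ZMod.natCast_zmod_val, mul_comm] at h
      split_ifs at h
      · exact absurd h hmk
      · exact h
    rw [if_neg fun h => hmk h.1, hmk', hψm]
    ring

end Shift

/-- For `n = 2^r·p` (`p` an odd prime, `r ≥ 2`) and any integer `q` coprime to
`n`, the circulant multigraphs with connection multisets `Ã = A ⊎ q·A` and
`B̃ = B ⊎ q·B` are isospectral. -/
theorem extended_construction_isospectral (p r : ℕ) (hp : p.Prime)
    (hodd : Odd p) (hr : 2 ≤ r) (n : ℕ) [NeZero n] (hn : n = 2 ^ r * p)
    (q : ℤ) (hq : Int.gcd q n = 1) :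
    (circulantAdj n
        ((connA n r p).val + (connA n r p).val.map fun a => (q : ZMod n) * a)).charpoly =
    (circulantAdj n
        ((connB n r p).val + (connB n r p).val.map fun b => (q : ZMod n) * b)).charpoly := by
  have hqu : IsUnit (q : ZMod n) := by
    rw [ZMod.coe_int_isUnit_iff_isCoprime]
    exact (Int.isCoprime_iff_gcd_eq_one.mpr hq).symm
  have hqm : (q : ZMod n) * (n / 2 : ℕ) = (n / 2 : ℕ) := by
    have h := natCast_mul_half hr hn (q : ZMod n).val
    rw [ZMod.natCast_zmod_val] at h
    split_ifs at h
    · exact absurd (hqu.mul_right_eq_zero.mp h) (half_ne_zero hr hn)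
    · exact h
  have hψ := ZMod.isPrimitive_stdAddChar n
  have hsum : ∀ (S : Finset (ZMod n)) (k : ZMod n),
      ((S.val + S.val.map fun a => (q : ZMod n) * a).map fun s => ZMod.stdAddChar (s * k)).sum =
        ∑ a ∈ S, ZMod.stdAddChar (a * k) + ∑ a ∈ S, ZMod.stdAddChar (a * ((q : ZMod n) * k)) := by
    intro S k
    simp only [Multiset.map_add, Multiset.sum_add, Multiset.map_map, Function.comp_apply,
      Finset.sum, mul_assoc, mul_left_comm _ (q : ZMod n)]
  rw [circulantAdj_charpoly _ hψ, circulantAdj_charpoly _ hψ,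
    ← Equiv.prod_comp (frequencyShift_involutive hr hn).toPerm]
  refine Finset.prod_congr rfl fun k _ => ?_
  rw [hsum, hsum, Function.Involutive.coe_toPerm, mul_frequencyShift hqu hqm,
    sum_connA_frequencyShift _ hψ hodd hr hn, sum_connA_frequencyShift _ hψ hodd hr hn]
end
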